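/- arXiv:0904.2794 — 3 statements merged into one kernel-verified Lean document; each statement's English description precedes it below -/
import Mathlib

section
/- For every 2×2 complex matrix R there is exactly one matrix N from the following list such that N = c·A*·R·A for some nonzero complex scalar c and some invertible 2×2 complex matrix A (where A* denotes the conjugate transpose of A): (1) the diagonal matrix diag(1, e^{iθ}) with 0 ≤ θ ≤ π; (2) the matrix with rows (0,1),(τ,0) with 0 ≤ τ < 1; (3) the matrix with rows (0,1),(1,i); (4) diag(1,0); (5) the zero matrix. That is, every R is equivalent to at least one such N, and no two distinct matrices from the list (including the same family with distinct parameter values θ or τ) are equivalent to each other. -/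
open Matrix Complex

/-- Two 2×2 complex matrices are equivalent if `R' = c • (Aᴴ * R * A)` for some
nonzero scalar `c` and invertible matrix `A`. -/
def MatEquiv (R R' : Matrix (Fin 2) (Fin 2) ℂ) : Prop :=
  ∃ (c : ℂ) (A : Matrix (Fin 2) (Fin 2) ℂ), c ≠ 0 ∧ IsUnit A ∧ R' = c • (Aᴴ * R * A)

/-- The list of normal forms from Proposition 2.1 (Coffman, Theorem 4.3 of [ac]). -/
def IsNormalForm (N : Matrix (Fin 2) (Fin 2) ℂ) : Prop :=
  (∃ θ : ℝ, 0 ≤ θ ∧ θ ≤ Real.pi ∧ N = !![1, 0; 0, Complex.exp (θ * Complex.I)]) ∨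
  (∃ τ : ℝ, 0 ≤ τ ∧ τ < 1 ∧ N = !![0, 1; (τ : ℂ), 0]) ∨
  N = !![0, 1; 1, Complex.I] ∨
  N = !![1, 0; 0, 0] ∨
  N = 0

open ComplexConjugate in
theorem matEquiv_of_entries (a b c d k p q r s : ℂ) {N : Matrix (Fin 2) (Fin 2) ℂ} (hk : k ≠ 0)
    (hdet : p * s - q * r ≠ 0)
    (h00 : N 0 0 = k * (conj p * (a * p + b * r) + conj r * (c * p + d * r)))
    (h01 : N 0 1 = k * (conj p * (a * q + b * s) + conj r * (c * q + d * s)))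
    (h10 : N 1 0 = k * (conj q * (a * p + b * r) + conj s * (c * p + d * r)))
    (h11 : N 1 1 = k * (conj q * (a * q + b * s) + conj s * (c * q + d * s))) :
    MatEquiv !![a, b; c, d] N := by
  refine ⟨k, !![p, q; r, s], hk, ?_, ?_⟩
  · rw [Matrix.isUnit_iff_isUnit_det, Matrix.det_fin_two_of]
    exact isUnit_iff_ne_zero.2 hdet
  · ext i j
    fin_cases i <;> fin_cases j <;>
      simp [Matrix.mul_apply, Fin.sum_univ_two, h00, h01, h10, h11, -mul_eq_mul_left_iff] <;> ring

theorem MatEquiv.symm {R S : Matrix (Fin 2) (Fin 2) ℂ} (h : MatEquiv R S) : MatEquiv S R := by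
  obtain ⟨c, A, hc, hA, rfl⟩ := h
  obtain ⟨B, hAB, -⟩ := isUnit_iff_exists.1 hA
  refine ⟨c⁻¹, B, inv_ne_zero hc, ?_, ?_⟩
  · exact IsUnit.of_mul_eq_one_right A hAB
  · have h2 : Bᴴ * Aᴴ = 1 := by rw [← Matrix.conjTranspose_mul, hAB, Matrix.conjTranspose_one]
    calc R = Bᴴ * Aᴴ * R * (A * B) := by rw [h2, hAB]; simp
      _ = _ := by
        rw [Matrix.mul_smul, Matrix.smul_mul, smul_smul, inv_mul_cancel₀ hc, one_smul]
        simp only [Matrix.mul_assoc]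

theorem MatEquiv.trans {R S T : Matrix (Fin 2) (Fin 2) ℂ} (h : MatEquiv R S) (h' : MatEquiv S T) :
    MatEquiv R T := by
  obtain ⟨c, A, hc, hA, rfl⟩ := h
  obtain ⟨d, B, hd, hB, rfl⟩ := h'
  refine ⟨d * c, A * B, mul_ne_zero hd hc, hA.mul hB, ?_⟩
  rw [Matrix.mul_smul, Matrix.smul_mul, smul_smul, Matrix.conjTranspose_mul]
  simp only [Matrix.mul_assoc]

theorem MatEquiv.refl (R : Matrix (Fin 2) (Fin 2) ℂ) : MatEquiv R R :=
  ⟨1, 1, one_ne_zero, isUnit_one, by simp⟩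

/-- `R` is equivalent to some normal form. -/
def HasNormalForm (R : Matrix (Fin 2) (Fin 2) ℂ) : Prop :=
  ∃ N, IsNormalForm N ∧ MatEquiv R N

theorem HasNormalForm.of_matEquiv {R S : Matrix (Fin 2) (Fin 2) ℂ} (hS : HasNormalForm S)
    (h : MatEquiv R S) : HasNormalForm R :=
  let ⟨N, hN, hSN⟩ := hS
  ⟨N, hN, h.trans hSN⟩

theorem IsNormalForm.hasNormalForm {N : Matrix (Fin 2) (Fin 2) ℂ} (hN : IsNormalForm N) :
    HasNormalForm N :=
  ⟨N, hN, MatEquiv.refl N⟩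

theorem matEquiv_swap (a b c d : ℂ) : MatEquiv !![a, b; c, d] !![d, c; b, a] := by
  apply matEquiv_of_entries a b c d 1 0 1 1 0 <;> simp

theorem hasNormalForm_diag_unit {u : ℂ} (hu : ‖u‖ = 1) : HasNormalForm !![1, 0; 0, u] := by
  have hexp : Complex.exp (u.arg * Complex.I) = u := by
    simpa [hu] using Complex.norm_mul_exp_arg_mul_I u
  have hu0 : u ≠ 0 := by
    rintro rfl
    simp at hu
  rcases le_total 0 u.arg with h | h
  · exact IsNormalForm.hasNormalForm (.inl ⟨u.arg, h, Complex.arg_le_pi u, by rw [hexp]⟩)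
  · refine HasNormalForm.of_matEquiv (S := !![1, 0; 0, u⁻¹])
      (IsNormalForm.hasNormalForm (.inl ⟨-u.arg, by linarith, ?_, ?_⟩)) ?_
    · linarith [Complex.neg_pi_lt_arg u]
    · rw [Complex.ofReal_neg, neg_mul, Complex.exp_neg, hexp]
    · apply matEquiv_of_entries 1 0 0 u u⁻¹ 0 1 1 0 <;> simp [hu0]

theorem hasNormalForm_diag (a d : ℂ) : HasNormalForm !![a, 0; 0, d] := by
  have hsingle : ∀ z : ℂ, HasNormalForm !![z, 0; 0, 0] := by
    intro z
    by_cases hz : z = 0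
    · subst hz
      exact IsNormalForm.hasNormalForm (.inr (.inr (.inr (.inr (by
        ext i j; fin_cases i <;> fin_cases j <;> rfl)))))
    · refine HasNormalForm.of_matEquiv (S := !![1, 0; 0, 0])
        (IsNormalForm.hasNormalForm (.inr (.inr (.inr (.inl rfl))))) ?_
      apply matEquiv_of_entries z 0 0 0 z⁻¹ 1 0 0 1 <;> simp [hz]
  by_cases hd : d = 0
  · subst hd
    exact hsingle a
  by_cases ha : a = 0
  · subst ha
    exact (hsingle d).of_matEquiv (matEquiv_swap _ _ _ _)
  have hr : 0 < ‖a‖ / ‖d‖ := div_pos (norm_pos_iff.2 ha) (norm_pos_iff.2 hd)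
  have hs : ((√(‖a‖ / ‖d‖) : ℝ) : ℂ) ≠ 0 := by
    exact_mod_cast (Real.sqrt_pos.2 hr).ne'
  have hs2 : ((√(‖a‖ / ‖d‖) : ℝ) : ℂ) * ((√(‖a‖ / ‖d‖) : ℝ) : ℂ) = ((‖a‖ / ‖d‖ : ℝ) : ℂ) := by
    exact_mod_cast Real.mul_self_sqrt hr.le
  refine HasNormalForm.of_matEquiv (S := !![1, 0; 0, a⁻¹ * (((‖a‖ / ‖d‖ : ℝ) : ℂ) * d)])
    (hasNormalForm_diag_unit ?_) ?_
  · have := norm_ne_zero_iff.2 ha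
    have := norm_ne_zero_iff.2 hd
    rw [norm_mul, norm_mul, norm_inv, Complex.norm_real, Real.norm_of_nonneg hr.le]
    field_simp
  · apply matEquiv_of_entries a 0 0 d a⁻¹ 1 0 0 ((√(‖a‖ / ‖d‖) : ℝ) : ℂ)
    · simp [ha]
    · simpa using hs
    · simp [ha]
    · simp
    · simp
    · simp only [Complex.conj_ofReal]
      rw [← hs2]
      simp [-mul_eq_mul_left_iff]
      ring

/-- The off-diagonal entries can be rescaled to `1` and a nonnegative real. -/
theorem exists_matEquiv_zero_one_real {b : ℂ} (hb : b ≠ 0) (c d : ℂ) :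
    ∃ d', (d = 0 → d' = 0) ∧
      MatEquiv !![0, b; c, d] !![0, 1; ((‖c‖ / ‖b‖ : ℝ) : ℂ), d'] := by
  set s : ℂ := Complex.exp (((c / b).arg / 2 : ℝ) * Complex.I) with hs
  have hs0 : s ≠ 0 := Complex.exp_ne_zero _
  have hconj : (starRingEnd ℂ) s * s = 1 := by
    rw [← Complex.normSq_eq_conj_mul_self, Complex.normSq_eq_norm_sq, hs,
      Complex.norm_exp_ofReal_mul_I]
    simp
  have hc : c = ((‖c‖ / ‖b‖ : ℝ) : ℂ) * (s * s) * b := by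
    have h1 : s * s = Complex.exp ((c / b).arg * Complex.I) := by
      rw [hs, ← Complex.exp_add]
      congr 1
      push_cast
      ring
    rw [h1, ← norm_div, Complex.norm_mul_exp_arg_mul_I, div_mul_cancel₀ _ hb]
  refine ⟨(s * b)⁻¹ * d, by rintro rfl; simp, ?_⟩
  apply matEquiv_of_entries 0 b c d (s * b)⁻¹ 1 0 0 s
  · simp [hs0, hb]
  · simpa using hs0
  · simp
  · simp
    field_simp
  · have : (starRingEnd ℂ) s * c = ((‖c‖ / ‖b‖ : ℝ) : ℂ) * (s * b) := by
      conv_lhs => rw [hc]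
      linear_combination ((‖c‖ / ‖b‖ : ℝ) : ℂ) * s * b * hconj
    have hsb : s * b ≠ 0 := mul_ne_zero hs0 hb
    simp only [Matrix.of_apply, Matrix.cons_val', Matrix.cons_val_zero, Matrix.cons_val_one,
      mul_one, mul_zero, add_zero, zero_add, map_zero, this]
    simp
    field_simp
  · have : (starRingEnd ℂ) s * (d * s) = d := by linear_combination d * hconj
    simp [this]

theorem hasNormalForm_antidiag (b c : ℂ) : HasNormalForm !![0, b; c, 0] := by
  wlog h : ‖c‖ ≤ ‖b‖ generalizing b c
  · exact (this c b (le_of_not_ge h)).of_matEquiv (matEquiv_swap _ _ _ _)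
  by_cases hb : b = 0
  · subst hb
    obtain rfl : c = 0 := by simpa using h
    exact hasNormalForm_diag 0 0
  obtain ⟨d', hd', hE⟩ := exists_matEquiv_zero_one_real hb c 0
  obtain rfl := hd' rfl
  refine HasNormalForm.of_matEquiv ?_ hE
  have hb' : 0 < ‖b‖ := norm_pos_iff.2 hb
  rcases h.lt_or_eq with h | h
  · exact IsNormalForm.hasNormalForm (.inr (.inl
      ⟨‖c‖ / ‖b‖, by positivity, (div_lt_one hb').2 h, rfl⟩))
  · rw [h, div_self hb'.ne', Complex.ofReal_one]
    refine (hasNormalForm_diag 1 (-1)).of_matEquiv ?_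
    apply matEquiv_of_entries 0 1 1 0 (1 / 2) 1 1 1 (-1) <;> norm_num

theorem hasNormalForm_zero_one_one (d : ℂ) : HasNormalForm !![0, 1; 1, d] := by
  have hshift : MatEquiv !![0, 1; 1, d] !![0, 1; 1, (d.im : ℂ) * Complex.I] := by
    apply matEquiv_of_entries 0 1 1 d 1 1 ((-(d.re / 2) : ℝ) : ℂ) 0 1 <;>
      simp [-Complex.ofReal_neg, -Complex.ofReal_div, Complex.conj_ofReal]
    push_cast
    linear_combination Complex.re_add_im d
  refine HasNormalForm.of_matEquiv ?_ hshift
  generalize d.im = y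
  have hpos : ∀ y : ℝ, 0 < y → HasNormalForm !![0, 1; 1, (y : ℂ) * Complex.I] := by
    intro y hy
    have hs : ((√y : ℝ) : ℂ) ≠ 0 := by exact_mod_cast (Real.sqrt_pos.2 hy).ne'
    have hs2 : ((√y : ℝ) : ℂ) * ((√y : ℝ) : ℂ) = (y : ℂ) := by
      exact_mod_cast Real.mul_self_sqrt hy.le
    refine HasNormalForm.of_matEquiv (IsNormalForm.hasNormalForm (.inr (.inr (.inl rfl)))) ?_
    apply matEquiv_of_entries 0 1 1 (y * Complex.I) 1 (√y : ℝ) 0 0 ((√y : ℝ) : ℂ)⁻¹ <;>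
      simp [hs]
    rw [← hs2]
    field_simp
  rcases lt_trichotomy y 0 with hy | rfl | hy
  · refine (hpos (-y) (by linarith)).of_matEquiv ?_
    apply matEquiv_of_entries 0 1 1 (y * Complex.I) (-1) (-1) 0 0 1 <;> simp
  · simpa using hasNormalForm_antidiag 1 1
  · exact hpos y hy

theorem hasNormalForm_of_isotropic (b c d : ℂ) : HasNormalForm !![0, b; c, d] := by
  by_cases h : ‖b‖ = ‖c‖
  · by_cases hb : b = 0
    · subst hb
      obtain rfl : c = 0 := by simpa using h.symm
      exact hasNormalForm_diag 0 d
    · obtain ⟨d', -, hE⟩ := exists_matEquiv_zero_one_real hb c d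
      rw [← h, div_self (norm_ne_zero_iff.2 hb), Complex.ofReal_one] at hE
      exact (hasNormalForm_zero_one_one d').of_matEquiv hE
  · have hD : c * (starRingEnd ℂ) c - b * (starRingEnd ℂ) b ≠ 0 := by
      intro h0
      apply h
      rw [Complex.mul_conj, Complex.mul_conj, Complex.normSq_eq_norm_sq,
        Complex.normSq_eq_norm_sq, sub_eq_zero] at h0
      have h1 : ‖c‖ ^ 2 = ‖b‖ ^ 2 := by exact_mod_cast h0
      exact ((sq_eq_sq₀ (norm_nonneg _) (norm_nonneg _)).1 h1).symm
    refine (hasNormalForm_antidiag b c).of_matEquiv ?_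
    apply matEquiv_of_entries 0 b c d 1 1
      (((starRingEnd ℂ) d * b - d * (starRingEnd ℂ) c) /
        (c * (starRingEnd ℂ) c - b * (starRingEnd ℂ) b)) 0 1 <;> simp
    rw [mul_comm ((starRingEnd ℂ) c) c, mul_comm ((starRingEnd ℂ) b) b]
    generalize hDef : c * (starRingEnd ℂ) c - b * (starRingEnd ℂ) b = D at hD ⊢
    field_simp
    linear_combination d * hDef

open ComplexConjugate in
theorem hasNormalForm_of_entries (a b c d : ℂ) : HasNormalForm !![a, b; c, d] := by
  by_cases hiso : ∃ x y : ℂ, (x ≠ 0 ∨ y ≠ 0) ∧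
      conj x * (a * x + b * y) + conj y * (c * x + d * y) = 0
  · obtain ⟨x, y, hxy, h0⟩ := hiso
    refine (hasNormalForm_of_isotropic
      (conj x * (a * -conj y + b * conj x) + conj y * (c * -conj y + d * conj x))
      (conj (-conj y) * (a * x + b * y) + conj (conj x) * (c * x + d * y))
      (conj (-conj y) * (a * -conj y + b * conj x)
        + conj (conj x) * (c * -conj y + d * conj x))).of_matEquiv ?_
    apply matEquiv_of_entries a b c d 1 x (-conj y) y (conj x)
    · exact one_ne_zero
    · intro h
      have h2 : Complex.normSq x + Complex.normSq y = 0 := by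
        have : (Complex.normSq x : ℂ) + Complex.normSq y = 0 := by
          rw [← Complex.mul_conj, ← Complex.mul_conj]
          linear_combination h
        exact_mod_cast this
      have hx := Complex.normSq_nonneg x
      have hy := Complex.normSq_nonneg y
      rcases hxy with h' | h'
      · exact h' (Complex.normSq_eq_zero.1 (by linarith))
      · exact h' (Complex.normSq_eq_zero.1 (by linarith))
    · simpa using h0.symm
    · simp
    · simp
    · simp
  have hker : ∀ p q r s : ℂ, p * s - q * r = 0 →
      ∃ x y : ℂ, (x ≠ 0 ∨ y ≠ 0) ∧ p * x + q * y = 0 ∧ r * x + s * y = 0 := by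
    intro p q r s h
    have hdet : (!![p, q; r, s] : Matrix (Fin 2) (Fin 2) ℂ).det = 0 := by
      rw [Matrix.det_fin_two_of, h]
    obtain ⟨v, hv, hv0⟩ := Matrix.exists_mulVec_eq_zero_iff.2 hdet
    refine ⟨v 0, v 1, ?_, ?_, ?_⟩
    · by_contra! hcon
      exact hv (by ext i; fin_cases i <;> simp [hcon])
    · simpa [Matrix.mulVec, dotProduct] using congrFun hv0 0
    · simpa [Matrix.mulVec, dotProduct] using congrFun hv0 1
  by_cases hdet : a * d - b * c = 0
  · obtain ⟨x, y, hxy, h1, h2⟩ := hker a b c d hdet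
    exact absurd ⟨x, y, hxy, by rw [h1, h2]; simp⟩ hiso
  obtain ⟨μ, hμ⟩ : ∃ μ : ℂ, (a - μ * conj a) * (d - μ * conj d)
      - (b - μ * conj c) * (c - μ * conj b) = 0 := by
    have hA : conj a * conj d - conj b * conj c ≠ 0 := by
      rw [← map_mul, ← map_mul, ← map_sub]
      simpa only [ne_eq, map_eq_zero] using hdet
    obtain ⟨s, hs⟩ := IsAlgClosed.exists_pow_nat_eq
      (discrim (conj a * conj d - conj b * conj c)
        (-(a * conj d + d * conj a - b * conj b - c * conj c)) (a * d - b * c)) two_pos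
    obtain ⟨μ, hμ⟩ := exists_quadratic_eq_zero hA ⟨s, by rw [← hs, sq]⟩
    exact ⟨μ, by linear_combination hμ⟩
  obtain ⟨x, y, hxy, h1, h2⟩ := hker _ _ _ _ hμ
  have hq : conj x * (a * x + b * y) + conj y * (c * x + d * y) ≠ 0 :=
    fun h => hiso ⟨x, y, hxy, h⟩
  have hsplit : a * x + b * y = μ * (conj a * x + conj c * y) ∧
      c * x + d * y = μ * (conj b * x + conj d * y) :=
    ⟨by linear_combination h1, by linear_combination h2⟩
  set w₀ := conj x * a + conj y * c with hw₀
  set w₁ := conj x * b + conj y * d with hw₁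
  refine (hasNormalForm_diag
    (conj x * (a * x + b * y) + conj y * (c * x + d * y))
    (conj (-w₁) * (a * -w₁ + b * w₀) + conj w₀ * (c * -w₁ + d * w₀))).of_matEquiv ?_
  apply matEquiv_of_entries a b c d 1 x (-w₁) y w₀
  · exact one_ne_zero
  · intro h
    apply hq
    rw [hw₀, hw₁] at h
    linear_combination h
  · simp
  · simp [hw₀, hw₁]
    ring
  · rw [hsplit.1, hsplit.2]
    simp [hw₀, hw₁]
    ring
  · simp

theorem exists_hasNormalForm (R : Matrix (Fin 2) (Fin 2) ℂ) : HasNormalForm R := by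
  rw [Matrix.eta_fin_two R]
  exact hasNormalForm_of_entries _ _ _ _

/-- The middle coefficient of the quadratic form `det (z • R + w • Rᴴ)`. -/
noncomputable def mixedDet (R : Matrix (Fin 2) (Fin 2) ℂ) : ℝ :=
  2 * (R 0 0 * (starRingEnd ℂ) (R 1 1)).re - Complex.normSq (R 0 1) - Complex.normSq (R 1 0)

open ComplexConjugate in
theorem mixedDet_cast (R : Matrix (Fin 2) (Fin 2) ℂ) :
    (mixedDet R : ℂ) = R 0 0 * conj (R 1 1) + conj (R 0 0) * R 1 1
      - R 0 1 * conj (R 0 1) - R 1 0 * conj (R 1 0) := by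
  have h := Complex.add_conj (R 0 0 * conj (R 1 1))
  rw [map_mul, Complex.conj_conj] at h
  rw [mixedDet, Complex.ofReal_sub, Complex.ofReal_sub, ← h, ← Complex.mul_conj,
    ← Complex.mul_conj]

theorem MatEquiv.exists_scale {R S : Matrix (Fin 2) (Fin 2) ℂ} (h : MatEquiv R S) :
    ∃ r : ℝ, 0 < r ∧ ‖S.det‖ = r * ‖R.det‖ ∧ mixedDet S = r * mixedDet R := by
  obtain ⟨c, A, hc, hA, rfl⟩ := h
  have hdet : A.det ≠ 0 := ((Matrix.isUnit_iff_isUnit_det A).1 hA).ne_zero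
  refine ⟨Complex.normSq (c * A.det),
    Complex.normSq_pos.2 (mul_ne_zero hc hdet), ?_, ?_⟩
  · rw [Matrix.det_smul, Matrix.det_mul, Matrix.det_mul, Matrix.det_conjTranspose,
      Complex.normSq_eq_norm_sq]
    simp
    ring
  · apply Complex.ofReal_injective
    rw [Complex.ofReal_mul, mixedDet_cast, mixedDet_cast, ← Complex.mul_conj, Matrix.det_fin_two]
    simp only [Matrix.smul_apply, Matrix.mul_apply, Fin.sum_univ_two, Matrix.conjTranspose_apply,
      smul_eq_mul, map_mul, map_add, map_sub, RCLike.star_def, Complex.conj_conj]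
    ring

theorem MatEquiv.conjTranspose_eq_smul {R S : Matrix (Fin 2) (Fin 2) ℂ} (h : MatEquiv R S)
    (hR : Rᴴ = R) : ∃ k : ℂ, Sᴴ = k • S := by
  obtain ⟨c, A, hc, -, rfl⟩ := h
  refine ⟨star c / c, ?_⟩
  rw [smul_smul, div_mul_cancel₀ _ hc, Matrix.conjTranspose_smul, Matrix.conjTranspose_mul,
    Matrix.conjTranspose_mul, Matrix.conjTranspose_conjTranspose, hR, Matrix.mul_assoc]

theorem mixedDet_diag (θ : ℝ) :
    mixedDet !![1, 0; 0, Complex.exp (θ * Complex.I)] = 2 * Real.cos θ := by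
  simp [mixedDet, Complex.exp_ofReal_mul_I_re]

theorem norm_det_diag (θ : ℝ) :
    ‖(!![1, 0; 0, Complex.exp (θ * Complex.I)] : Matrix (Fin 2) (Fin 2) ℂ).det‖ = 1 := by
  simp [Matrix.det_fin_two_of, Complex.norm_exp_ofReal_mul_I]

theorem mixedDet_antidiag (τ : ℝ) : mixedDet !![0, 1; (τ : ℂ), 0] = -(1 + τ ^ 2) := by
  simp [mixedDet]
  ring

theorem norm_det_antidiag {τ : ℝ} (h : 0 ≤ τ) :
    ‖(!![0, 1; (τ : ℂ), 0] : Matrix (Fin 2) (Fin 2) ℂ).det‖ = τ := by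
  simp [Matrix.det_fin_two_of, abs_of_nonneg h]

theorem mixedDet_jordan : mixedDet !![0, 1; 1, Complex.I] = -2 := by
  simp [mixedDet]
  norm_num

theorem norm_det_jordan :
    ‖(!![0, 1; 1, Complex.I] : Matrix (Fin 2) (Fin 2) ℂ).det‖ = 1 := by
  simp [Matrix.det_fin_two_of]

theorem mixedDet_rank_one : mixedDet !![1, 0; 0, 0] = 0 := by
  simp [mixedDet]

theorem norm_det_rank_one :
    ‖(!![1, 0; 0, 0] : Matrix (Fin 2) (Fin 2) ℂ).det‖ = 0 := by
  simp [Matrix.det_fin_two_of]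

theorem MatEquiv.eq_zero {S : Matrix (Fin 2) (Fin 2) ℂ} (h : MatEquiv 0 S) : S = 0 := by
  obtain ⟨c, A, -, -, rfl⟩ := h
  simp

theorem not_matEquiv_diag_antidiag {θ τ : ℝ} (h0 : 0 ≤ τ) (h1 : τ < 1) :
    ¬ MatEquiv !![1, 0; 0, Complex.exp (θ * Complex.I)] !![0, 1; (τ : ℂ), 0] := by
  intro h
  obtain ⟨r, -, hd, hm⟩ := h.exists_scale
  rw [norm_det_diag, norm_det_antidiag h0] at hd
  rw [mixedDet_diag, mixedDet_antidiag] at hm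
  nlinarith [Real.neg_one_le_cos θ, mul_pos (sub_pos.2 h1) (sub_pos.2 h1)]

theorem not_matEquiv_diag_jordan {θ : ℝ} (h0 : 0 ≤ θ) (h1 : θ ≤ Real.pi) :
    ¬ MatEquiv !![1, 0; 0, Complex.exp (θ * Complex.I)] !![0, 1; 1, Complex.I] := by
  intro h
  obtain ⟨r, -, hd, hm⟩ := h.exists_scale
  rw [norm_det_diag, norm_det_jordan] at hd
  rw [mixedDet_diag, mixedDet_jordan] at hm
  obtain rfl : r = 1 := by linarith
  obtain rfl : θ = Real.pi := Real.injOn_cos ⟨h0, h1⟩ ⟨Real.pi_pos.le, le_rfl⟩ (by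
    rw [Real.cos_pi]; linarith)
  obtain ⟨k, hk⟩ := h.conjTranspose_eq_smul (by
    rw [Complex.exp_pi_mul_I]
    ext i j
    fin_cases i <;> fin_cases j <;> simp)
  have h01 := congrFun (congrFun hk 0) 1
  have h11 := congrFun (congrFun hk 1) 1
  simp at h01 h11
  rw [← h01] at h11
  have := congrArg Complex.im h11
  norm_num at this

theorem not_matEquiv_antidiag_jordan {τ : ℝ} (h0 : 0 ≤ τ) (h1 : τ < 1) :
    ¬ MatEquiv !![0, 1; (τ : ℂ), 0] !![0, 1; 1, Complex.I] := by
  intro h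
  obtain ⟨r, -, hd, hm⟩ := h.symm.exists_scale
  rw [norm_det_jordan, norm_det_antidiag h0] at hd
  rw [mixedDet_jordan, mixedDet_antidiag] at hm
  nlinarith [mul_pos (sub_pos.2 h1) (sub_pos.2 h1)]

theorem not_matEquiv_rank_one {R : Matrix (Fin 2) (Fin 2) ℂ}
    (hR : ‖R.det‖ ≠ 0 ∨ mixedDet R ≠ 0) : ¬ MatEquiv !![1, 0; 0, 0] R := by
  intro h
  obtain ⟨r, -, hd, hm⟩ := h.exists_scale
  rw [norm_det_rank_one, mul_zero] at hd
  rw [mixedDet_rank_one, mul_zero] at hm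
  tauto

theorem matEquiv_diag_eq {θ φ : ℝ} (h0 : 0 ≤ θ) (h1 : θ ≤ Real.pi) (h0' : 0 ≤ φ)
    (h1' : φ ≤ Real.pi)
    (h : MatEquiv !![1, 0; 0, Complex.exp (θ * Complex.I)]
      !![1, 0; 0, Complex.exp (φ * Complex.I)]) : θ = φ := by
  obtain ⟨r, -, hd, hm⟩ := h.exists_scale
  rw [norm_det_diag, norm_det_diag] at hd
  rw [mixedDet_diag, mixedDet_diag] at hm
  obtain rfl : r = 1 := by linarith
  exact Real.injOn_cos ⟨h0, h1⟩ ⟨h0', h1'⟩ (by linarith)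

theorem matEquiv_antidiag_eq {σ τ : ℝ} (h0 : 0 ≤ σ) (h1 : σ < 1) (h0' : 0 ≤ τ) (h1' : τ < 1)
    (h : MatEquiv !![0, 1; (σ : ℂ), 0] !![0, 1; (τ : ℂ), 0]) : σ = τ := by
  obtain ⟨r, -, hd, hm⟩ := h.exists_scale
  rw [norm_det_antidiag h0, norm_det_antidiag h0'] at hd
  rw [mixedDet_antidiag, mixedDet_antidiag] at hm
  have hlt : σ * τ < 1 := by nlinarith
  have hprod : (1 - r) * (1 - σ * τ) = 0 := by
    subst hd
    linear_combination -hm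
  rcases mul_eq_zero.1 hprod with h | h
  · obtain rfl : r = 1 := by linarith
    linarith
  · linarith

theorem IsNormalForm.eq_of_matEquiv {M N : Matrix (Fin 2) (Fin 2) ℂ} (hM : IsNormalForm M)
    (hN : IsNormalForm N) (h : MatEquiv M N) : M = N := by
  have hdiag (θ : ℝ) : ¬ MatEquiv !![1, 0; 0, 0] !![1, 0; 0, Complex.exp (θ * Complex.I)] :=
    not_matEquiv_rank_one (.inl (by rw [norm_det_diag]; exact one_ne_zero))
  have hanti (τ : ℝ) : ¬ MatEquiv !![1, 0; 0, 0] !![0, 1; (τ : ℂ), 0] :=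
    not_matEquiv_rank_one (.inr (by rw [mixedDet_antidiag]; nlinarith [sq_nonneg τ]))
  have hjordan : ¬ MatEquiv !![1, 0; 0, 0] !![0, 1; 1, Complex.I] :=
    not_matEquiv_rank_one (.inl (by rw [norm_det_jordan]; exact one_ne_zero))
  rcases hM with ⟨θ, hθ, hθ', rfl⟩ | ⟨σ, hσ, hσ', rfl⟩ | rfl | rfl | rfl
  · rcases hN with ⟨φ, hφ, hφ', rfl⟩ | ⟨τ, hτ, hτ', rfl⟩ | rfl | rfl | rfl
    · rw [matEquiv_diag_eq hθ hθ' hφ hφ' h]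
    · exact absurd h (not_matEquiv_diag_antidiag hτ hτ')
    · exact absurd h (not_matEquiv_diag_jordan hθ hθ')
    · exact absurd h.symm (hdiag θ)
    · exact h.symm.eq_zero
  · rcases hN with ⟨φ, hφ, hφ', rfl⟩ | ⟨τ, hτ, hτ', rfl⟩ | rfl | rfl | rfl
    · exact absurd h.symm (not_matEquiv_diag_antidiag hσ hσ')
    · rw [matEquiv_antidiag_eq hσ hσ' hτ hτ' h]
    · exact absurd h (not_matEquiv_antidiag_jordan hσ hσ')
    · exact absurd h.symm (hanti σ)
    · exact h.symm.eq_zero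
  · rcases hN with ⟨φ, hφ, hφ', rfl⟩ | ⟨τ, hτ, hτ', rfl⟩ | rfl | rfl | rfl
    · exact absurd h.symm (not_matEquiv_diag_jordan hφ hφ')
    · exact absurd h.symm (not_matEquiv_antidiag_jordan hτ hτ')
    · rfl
    · exact absurd h.symm hjordan
    · exact h.symm.eq_zero
  · rcases hN with ⟨φ, -, -, rfl⟩ | ⟨τ, -, -, rfl⟩ | rfl | rfl | rfl
    · exact absurd h (hdiag φ)
    · exact absurd h (hanti τ)
    · exact absurd h hjordan
    · rfl
    · exact h.symm.eq_zero
  · exact h.eq_zero.symm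

/-- Every 2×2 complex matrix `R` is equivalent to exactly one normal form. -/
theorem normal_form_exists_unique (R : Matrix (Fin 2) (Fin 2) ℂ) :
    ∃! N : Matrix (Fin 2) (Fin 2) ℂ, IsNormalForm N ∧ MatEquiv R N := by
  obtain ⟨N, hN, hRN⟩ := exists_hasNormalForm R
  exact ⟨N, ⟨hN, hRN⟩, fun M ⟨hM, hRM⟩ => hM.eq_of_matEquiv hN (hRM.symm.trans hRN)⟩
end

section
/- For any m×m complex matrices R and P, the determinant of the 2m×2m block matrix Γ with block rows (R, conj(P)), (P, conj(R)) is a real number, i.e., det(Γ) equals its own complex conjugate. -/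
open Matrix Complex

/-- The determinant of the block matrix `Γ = [[R, conj P], [P, conj R]]` is real. -/
theorem det_gamma_real (m : ℕ) (R P : Matrix (Fin m) (Fin m) ℂ) :
    (starRingEnd ℂ)
        (Matrix.fromBlocks R (P.map (starRingEnd ℂ)) P (R.map (starRingEnd ℂ))).det =
      (Matrix.fromBlocks R (P.map (starRingEnd ℂ)) P (R.map (starRingEnd ℂ))).det := by
  rw [RingHom.map_det, ← det_submatrix_equiv_self (Equiv.sumComm (Fin m) (Fin m))]
  congr 1
  ext i j
  rcases i with i | i <;> rcases j with j | j <;> simp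
end

section
/- Let 0 < τ < 1 and let N be the 2×2 matrix with rows (0, 1), (τ, 0). Suppose c is a complex number and A is an invertible 2×2 complex matrix with entries α, β (first row) and γ, δ (second row), such that N = c·A*·N·A. Then β = 0, γ = 0, the product conj(α)·δ is a nonzero real number, and c = 1/(conj(α)·δ). -/
open Matrix Complex

/-- A complex number `z` with `τ * conj z + z = 0` vanishes when `0 < τ < 1`. -/
theorem eq_zero_of_mul_conj_add_self_eq_zero {τ : ℝ} (hτ1 : 0 < τ) (hτ2 : τ < 1) {z : ℂ}
    (h : (τ : ℂ) * starRingEnd ℂ z + z = 0) : z = 0 := by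
  have h1 := congrArg norm (eq_neg_of_add_eq_zero_left h)
  rw [norm_mul, norm_neg, RCLike.norm_conj, Complex.norm_real, Real.norm_of_nonneg hτ1.le] at h1
  have h2 : (1 - τ) * ‖z‖ = 0 := by linarith
  exact norm_eq_zero.mp ((mul_eq_zero.mp h2).resolve_left (by linarith))

/-- Case (2a): if `N = !![0, 1; τ, 0]` with `0 < τ < 1` and `N = c • (Aᴴ N A)` for an
invertible `A = !![α, β; γ, δ]`, then `β = 0`, `γ = 0`, `conj α * δ` is a nonzero real
number, and `c = 1/(conj α * δ)`. -/
theorem stabilizer_case_2a (τ : ℝ) (hτ1 : 0 < τ) (hτ2 : τ < 1)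
    (c α β γ δ : ℂ) (hA : IsUnit !![α, β; γ, δ])
    (hN : !![0, 1; (τ : ℂ), 0] =
      c • ((!![α, β; γ, δ])ᴴ * !![0, 1; (τ : ℂ), 0] * !![α, β; γ, δ])) :
    β = 0 ∧ γ = 0 ∧ (∃ r : ℝ, r ≠ 0 ∧ starRingEnd ℂ α * δ = (r : ℂ)) ∧
      c = 1 / (starRingEnd ℂ α * δ) := by
  have h11 := congrFun (congrFun hN 0) 0
  have h12 := congrFun (congrFun hN 0) 1
  have h21 := congrFun (congrFun hN 1) 0
  have h22 := congrFun (congrFun hN 1) 1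
  simp [Matrix.mul_apply, Fin.sum_univ_two] at h11 h12 h21 h22
  have hτ : (τ : ℂ) ≠ 0 := Complex.ofReal_ne_zero.mpr hτ1.ne'
  have hc : c ≠ 0 := by
    rintro rfl
    simp at h12
  have hαγ : starRingEnd ℂ α * γ = 0 := by
    refine eq_zero_of_mul_conj_add_self_eq_zero hτ1 hτ2 ?_
    simp only [map_mul, Complex.conj_conj]
    linear_combination h11.resolve_left hc
  have hβδ : starRingEnd ℂ β * δ = 0 := by
    refine eq_zero_of_mul_conj_add_self_eq_zero hτ1 hτ2 ?_
    simp only [map_mul, Complex.conj_conj]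
    linear_combination h22.resolve_left hc
  rcases mul_eq_zero.mp hαγ with hα | rfl
  · have hα0 : α = 0 := by simpa using hα
    subst hα0
    simp only [map_zero, zero_mul, mul_zero, add_zero, zero_add] at h12 h21
    have n12 := congrArg norm h12
    have n21 := congrArg norm h21
    simp only [norm_mul, RCLike.norm_conj, Complex.norm_real, norm_one,
      Real.norm_of_nonneg hτ1.le] at n12 n21
    nlinarith
  · simp only [map_zero, zero_mul, mul_zero, add_zero, zero_add] at h12 h21
    have hαδ : starRingEnd ℂ α * δ ≠ 0 := by
      intro h
      simp [h] at h12
    have hβ : β = 0 := by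
      simpa using (mul_eq_zero.mp hβδ).resolve_right (right_ne_zero_of_mul hαδ)
    have hconj : starRingEnd ℂ (starRingEnd ℂ α * δ) = starRingEnd ℂ α * δ := by
      rw [map_mul, Complex.conj_conj]
      refine mul_left_cancel₀ (mul_ne_zero hτ hc) ?_
      linear_combination (τ : ℂ) * h12 - h21
    obtain ⟨r, hr⟩ := Complex.conj_eq_iff_real.mp hconj
    refine ⟨hβ, rfl, ⟨r, ?_, hr⟩, ?_⟩
    · rintro rfl
      exact hαδ (by simpa using hr)
    · rw [eq_div_iff hαδ]
      exact h12.symm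
end
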